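/- For every k with 0 ≤ k ≤ N, the degree-(|λ|+k) homogeneous component G_λ[k] of the symmetric Grothendieck polynomial G_λ(x_1,...,x_n) has Newton polytope equal to the permutahedron P_{μ^(k)}, and G_λ[k] has saturated Newton polytope. -/

import Mathlib

open Finset

/-- Sum of the first `t` coordinates of a vector. -/
def psum {n : ℕ} (v : Fin n → ℝ) (t : ℕ) : ℝ := ∑ i : Fin n, if (i : ℕ) < t then v i else 0

/-- Sum of the first `t` coordinates of a vector of naturals. -/
def npsum {n : ℕ} (v : Fin n → ℕ) (t : ℕ) : ℕ := ∑ i : Fin n, if (i : ℕ) < t then v i else 0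

/-- The decreasing rearrangement `v↓` of a vector. -/
noncomputable def decSort {n : ℕ} (v : Fin n → ℝ) : Fin n → ℝ := fun i => v (Tuple.sort v i.rev)

/-- `Majorizes w v` : `v` is majorized by `w`. -/
def Majorizes {n : ℕ} (w v : Fin n → ℝ) : Prop :=
  (∀ t, psum (decSort v) t ≤ psum (decSort w) t) ∧ ∑ i, v i = ∑ i, w i

/-- The permutahedron of `v`: convex hull of the orbit of `v` under coordinate permutations. -/
noncomputable def permutahedron {n : ℕ} (v : Fin n → ℝ) : Set (Fin n → ℝ) :=
  convexHull ℝ {w | ∃ σ : Equiv.Perm (Fin n), w = v ∘ σ}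

/-- Row `ρ` (0-indexed; 1-indexed row `ρ+1`) can receive a box: the current excess over `lam`
is `< (ρ+1) - 1 = ρ` and adding a box keeps the shape a partition. -/
def AddableRow {n : ℕ} (lam mu : Fin n → ℕ) (ρ : Fin n) : Prop :=
  mu ρ < lam ρ + (ρ : ℕ) ∧ Antitone (Function.update mu ρ (mu ρ + 1))

/-- One step of the northmost-box-adding construction relative to the base partition `lam`. -/
def NorthStep {n : ℕ} (lam muprev munext : Fin n → ℕ) : Prop :=
  ∃ ρ : Fin n, AddableRow lam muprev ρ ∧ (∀ ρ' : Fin n, ρ' < ρ → ¬ AddableRow lam muprev ρ') ∧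
    munext = Function.update muprev ρ (muprev ρ + 1)

/-- A row- and column-strictly increasing skew tableau of shape `mu/lam` whose entries in
(1-indexed) row `r+1` lie in `{1, ..., r}`, i.e. are at most `(r+1) - 1`. -/
def IsFlaggedTableau {n : ℕ} (lam mu : Fin n → ℕ) (T : Fin n → ℕ → ℕ) : Prop :=
  (∀ i, lam i ≤ mu i) ∧
  (∀ r : Fin n, ∀ c, lam r ≤ c → c < mu r → 1 ≤ T r c ∧ T r c ≤ (r : ℕ)) ∧
  (∀ r : Fin n, ∀ c c', lam r ≤ c → c < c' → c' < mu r → T r c < T r c') ∧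
  (∀ r r' : Fin n, r < r' → ∀ c, lam r ≤ c → c < mu r → lam r' ≤ c → c < mu r' → T r c < T r' c)

/-- The number of flagged tableaux of shape `mu/lam` (tableaux normalized to vanish off the shape). -/
noncomputable def flaggedCount {n : ℕ} (lam mu : Fin n → ℕ) : ℕ :=
  Set.ncard {T : Fin n → ℕ → ℕ | IsFlaggedTableau lam mu T ∧
    ∀ (r : Fin n) (c : ℕ), (c < lam r ∨ mu r ≤ c) → T r c = 0}

/-- The coefficient `a_{lam,mu}` in the Schur expansion of the symmetric Grothendieck polynomial. -/
noncomputable def grothCoeff {n : ℕ} (lam mu : Fin n → ℕ) : ℝ :=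
  if Antitone mu ∧ ∀ i, lam i ≤ mu i then
    (-1 : ℝ) ^ (∑ i, mu i - ∑ i, lam i) * flaggedCount lam mu
  else 0

/-- A semistandard Young tableau of shape `lam` with entries in `{1, ..., n}`. -/
def IsSSYT {n : ℕ} (lam : Fin n → ℕ) (T : Fin n → ℕ → ℕ) : Prop :=
  (∀ r : Fin n, ∀ c, c < lam r → 1 ≤ T r c ∧ T r c ≤ n) ∧
  (∀ r : Fin n, ∀ c c', c ≤ c' → c' < lam r → T r c ≤ T r c') ∧
  (∀ r r' : Fin n, r < r' → ∀ c, c < lam r' → c < lam r → T r c < T r' c)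

/-- The Kostka number `K_{lam,α}`: the number of SSYT of shape `lam` and weight `α`. -/
noncomputable def kostka {n : ℕ} (lam : Fin n → ℕ) (α : Fin n →₀ ℕ) : ℕ :=
  Set.ncard {T : Fin n → ℕ → ℕ | IsSSYT lam T ∧ (∀ (r : Fin n) (c : ℕ), lam r ≤ c → T r c = 0) ∧
    ∀ i : Fin n, α i = Set.ncard {p : Fin n × ℕ | p.2 < lam p.1 ∧ T p.1 p.2 = (i : ℕ) + 1}}

/-- The Schur polynomial `s_lam(x_1, ..., x_n)`, as the generating polynomial of SSYT. -/
noncomputable def schur {n : ℕ} (lam : Fin n → ℕ) : MvPolynomial (Fin n) ℝ :=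
  ∑ α ∈ Finset.Iic (Finsupp.equivFunOnFinite.symm (fun _ : Fin n => ∑ i, lam i)),
    (kostka lam α : ℝ) • MvPolynomial.monomial α 1

/-- The symmetric Grothendieck polynomial `G_lam(x_1, ..., x_n) = ∑_mu a_{lam,mu} s_mu`. -/
noncomputable def grothendieck {n : ℕ} (lam : Fin n → ℕ) : MvPolynomial (Fin n) ℝ :=
  ∑ m ∈ Finset.Iic (Finsupp.equivFunOnFinite.symm (fun i : Fin n => lam i + (i : ℕ))),
    grothCoeff lam (fun i => m i) • schur (fun i => m i)

/-- The Newton polytope of a polynomial: convex hull of its exponent vectors. -/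
noncomputable def newton {n : ℕ} (f : MvPolynomial (Fin n) ℝ) : Set (Fin n → ℝ) :=
  convexHull ℝ ((fun α : Fin n →₀ ℕ => fun i => (α i : ℝ)) '' (f.support : Set (Fin n →₀ ℕ)))

/-- A polynomial has saturated Newton polytope (SNP) if every lattice point of its Newton
polytope is an exponent vector with nonzero coefficient. -/
def SNP {n : ℕ} (f : MvPolynomial (Fin n) ℝ) : Prop :=
  ∀ α : Fin n →₀ ℕ, (fun i => (α i : ℝ)) ∈ newton f → MvPolynomial.coeff α f ≠ 0

/-! ### Existence of semistandard tableaux -/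

theorem exists_ssyt_aux (m : ℕ) : ∀ (μ α : ℕ → ℕ), Antitone μ → (∀ i, m ≤ i → μ i = 0) →
    (∀ S : Finset ℕ, S ⊆ range m → ∑ i ∈ S, α i ≤ ∑ i ∈ range (#S), μ i) →
    ∑ i ∈ range m, α i = ∑ i ∈ range m, μ i →
    ∃ T : ℕ → ℕ → ℕ, (∀ r c, c < μ r → 1 ≤ T r c ∧ T r c ≤ m) ∧
      (∀ r c c', c ≤ c' → c' < μ r → T r c ≤ T r c') ∧
      (∀ r r', r < r' → ∀ c, c < μ r' → T r c < T r' c) ∧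
      ∀ i, i < m → ∑ r ∈ range m, #{c ∈ range (μ r) | T r c = i + 1} = α i := by
  induction m with
  | zero =>
    intro μ α _ h0 _ _
    refine ⟨fun _ _ => 0, ?_, ?_, ?_, ?_⟩
    · intro r c hc; rw [h0 r (Nat.zero_le _)] at hc; omega
    · intros; rfl
    · intro r r' _ c hc; rw [h0 r' (Nat.zero_le _)] at hc; omega
    · intro i hi; omega
  | succ m ih =>
    intro μ α hanti h0 hS hsum
    obtain ⟨a, ha⟩ : ∃ a, a = α m := ⟨_, rfl⟩
    have hrec : ∀ i, μ (i + 1) ≤ μ i := fun i => hanti (Nat.le_succ i)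
    have ha0 : a ≤ μ 0 := by
      have := hS {m} (by simp)
      simpa [ha] using this
    have ham : μ m ≤ a := by
      have := hS (range m) (by intro x; simp; omega)
      rw [card_range] at this
      rw [sum_range_succ, sum_range_succ] at hsum
      omega
    let ν : ℕ → ℕ := fun i => max (μ i) a + min (μ (i + 1)) a - a
    have hν : ∀ i, ν i = max (μ i) a + min (μ (i + 1)) a - a := fun i => rfl
    have hνle : ∀ i, ν i ≤ μ i := by intro i; have := hrec i; rw [hν]; omega
    have hleν : ∀ i, μ (i + 1) ≤ ν i := by intro i; have := hrec i; rw [hν]; omega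
    have hνanti : Antitone ν := antitone_nat_of_succ_le (fun i => (hνle (i + 1)).trans (hleν i))
    have hν0 : ∀ i, m ≤ i → ν i = 0 := by
      intro i hi
      have h1 := h0 (i + 1) (by omega)
      have h2 := hanti hi
      rw [hν]; omega
    have hps : ∀ t, ∑ i ∈ range t, ν i + (a - μ t) = ∑ i ∈ range t, μ i := by
      intro t
      induction t with
      | zero => simp; omega
      | succ t iht =>
        rw [sum_range_succ, sum_range_succ]
        have := hν t
        have := hrec t
        omega
    obtain ⟨T, hT1, hT2, hT3, hT4⟩ := ih ν α hνanti hν0 (by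
      intro S hSm
      have h1 := hS S (hSm.trans (by intro x; simp; omega))
      have hm : m ∉ S := fun h => by have := hSm h; simp at this
      have h2 := hS (insert m S) (by
        intro x hx
        rcases mem_insert.1 hx with rfl | hx
        · simp
        · have := hSm hx; simp at this ⊢; omega)
      rw [sum_insert hm, card_insert_of_notMem hm, sum_range_succ] at h2
      have := hps (#S)
      omega) (by
      have := hps m
      rw [sum_range_succ, sum_range_succ] at hsum
      omega)
    refine ⟨fun r c => if c < ν r then T r c else m + 1, ?_, ?_, ?_, ?_⟩
    · intro r c hc
      dsimp only
      split_ifs with h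
      · have := hT1 r c h; omega
      · omega
    · intro r c c' hcc hc'
      dsimp only
      split_ifs with h h' h'
      · exact hT2 r c c' hcc h'
      · have := hT1 r c h; omega
      · omega
      · omega
    · intro r r' hr c hc
      dsimp only
      have h1 : c < ν r := lt_of_lt_of_le hc ((hanti hr).trans (hleν r))
      rw [if_pos h1]
      split_ifs with h
      · exact hT3 r r' hr c h
      · have := hT1 r c h1; omega
    · intro i hi
      rcases Nat.lt_succ_iff_lt_or_eq.1 hi with hi | rfl
      · rw [← hT4 i hi, sum_range_succ]
        have hz : ∀ r, #{c ∈ range (μ r) | (if c < ν r then T r c else m + 1) = i + 1}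
            = #{c ∈ range (ν r) | T r c = i + 1} := by
          intro r
          congr 1
          ext c
          simp only [mem_filter, mem_range]
          have := hνle r
          split_ifs with h
          · constructor
            · rintro ⟨_, h2⟩; exact ⟨h, h2⟩
            · rintro ⟨_, h2⟩; exact ⟨by omega, h2⟩
          · constructor
            · rintro ⟨_, h2⟩; omega
            · rintro ⟨h2, _⟩; omega
        simp only [hz]
        rw [hν0 m le_rfl]
        simp
      · have hz : ∀ r, #{c ∈ range (μ r) | (if c < ν r then T r c else i + 1) = i + 1}
            = μ r - ν r := by
          intro r
          rw [← Nat.card_Ico]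
          congr 1
          ext c
          simp only [mem_filter, mem_range, mem_Ico]
          split_ifs with h
          · have := hT1 r c h
            omega
          · omega
        simp only [hz]
        have h1 : ∑ r ∈ range (i + 1), (μ r - ν r) + ∑ r ∈ range (i + 1), ν r
            = ∑ r ∈ range (i + 1), μ r := by
          rw [← sum_add_distrib]
          exact sum_congr rfl (fun r _ => Nat.sub_add_cancel (hνle r))
        have h2 := hps (i + 1)
        have h3 := h0 (i + 1) le_rfl
        omega

/-- Dominance of `α` by `μ`, in subset-sum form. -/
def Dom {n : ℕ} (μ α : Fin n → ℕ) : Prop :=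
  (∀ S : Finset (Fin n), ∑ i ∈ S, α i ≤ npsum μ (#S)) ∧ ∑ i, α i = ∑ i, μ i

theorem finite_tab {n : ℕ} (B K : ℕ) (s : Set (Fin n → ℕ → ℕ))
    (h1 : ∀ T ∈ s, ∀ r c, B ≤ c → T r c = 0) (h2 : ∀ T ∈ s, ∀ r c, T r c ≤ K) : s.Finite := by
  refine Set.Finite.of_injOn (f := fun T : Fin n → ℕ → ℕ => fun (r : Fin n) (c : Fin B) => T r c)
    (t := Set.Iic (fun _ _ => K)) ?_ ?_ (Set.finite_Iic _)
  · intro T hT r c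
    exact h2 T hT r c
  · intro T hT T' hT' h
    funext r c
    by_cases hc : c < B
    · exact congrFun (congrFun h r) ⟨c, hc⟩
    · rw [h1 T hT r c (by omega), h1 T' hT' r c (by omega)]

/-- Extension by zero. -/
def ext0 {n : ℕ} (v : Fin n → ℕ) (i : ℕ) : ℕ := if h : i < n then v ⟨i, h⟩ else 0

theorem ext0_fin {n : ℕ} (v : Fin n → ℕ) (i : Fin n) : ext0 v i = v i := by
  simp [ext0]

theorem ext0_antitone {n : ℕ} {v : Fin n → ℕ} (hv : Antitone v) : Antitone (ext0 v) := by
  intro i j hij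
  unfold ext0
  split_ifs with h1 h2
  · exact hv hij
  · omega
  · omega
  · omega

theorem sum_ext0 {n : ℕ} (v : Fin n → ℕ) : ∑ i ∈ range n, ext0 v i = ∑ i, v i := by
  rw [← Fin.sum_univ_eq_sum_range]
  simp [ext0_fin]

theorem npsum_ext0 {n : ℕ} (v : Fin n → ℕ) (t : ℕ) :
    npsum v t = ∑ i ∈ range t, ext0 v i := by
  have h : npsum v t = ∑ i ∈ range n, if i < t then ext0 v i else 0 := by
    rw [← Fin.sum_univ_eq_sum_range (fun i => if i < t then ext0 v i else 0)]
    simp [ext0_fin, npsum]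
  rw [h, ← sum_filter]
  apply sum_subset_zero_on_sdiff
  · intro i; simp
  · intro i hi
    simp only [mem_sdiff, mem_range, mem_filter, not_and] at hi
    have : ¬ i < n := fun hn => (hi.2 hn) hi.1
    simp [ext0, this]
  · intros; rfl

theorem kostka_set_finite {n : ℕ} (lam : Fin n → ℕ) (α : Fin n →₀ ℕ) :
    {T : Fin n → ℕ → ℕ | IsSSYT lam T ∧ (∀ (r : Fin n) (c : ℕ), lam r ≤ c → T r c = 0) ∧
    ∀ i : Fin n, α i =
      Set.ncard {p : Fin n × ℕ | p.2 < lam p.1 ∧ T p.1 p.2 = (i : ℕ) + 1}}.Finite := by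
  apply finite_tab (∑ i, lam i) n
  · rintro T ⟨_, h, _⟩ r c hc
    exact h r c ((single_le_sum (fun i _ => Nat.zero_le _) (mem_univ r)).trans hc)
  · rintro T ⟨h1, h2, _⟩ r c
    by_cases hc : c < lam r
    · exact (h1.1 r c hc).2
    · rw [h2 r c (by omega)]; omega

theorem ncard_cells {n : ℕ} (lam : Fin n → ℕ) (T : Fin n → ℕ → ℕ) (v : ℕ) :
    Set.ncard {p : Fin n × ℕ | p.2 < lam p.1 ∧ T p.1 p.2 = v}
      = ∑ r : Fin n, #{c ∈ range (lam r) | T r c = v} := by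
  have : {p : Fin n × ℕ | p.2 < lam p.1 ∧ T p.1 p.2 = v} =
      ((univ : Finset (Fin n)).sigma (fun r => {c ∈ range (lam r) | T r c = v})).map
        (Equiv.sigmaEquivProd (Fin n) ℕ).toEmbedding := by
    ext ⟨r, c⟩
    simp [Equiv.sigmaEquivProd]
  rw [this, Set.ncard_coe_finset, card_map, card_sigma]

theorem kostka_ne_zero_of_dom {n : ℕ} {μ : Fin n → ℕ} (hμ : Antitone μ) {α : Fin n →₀ ℕ}
    (h : Dom μ α) : kostka μ α ≠ 0 := by
  obtain ⟨T, h1, h2, h3, h4⟩ := exists_ssyt_aux n (ext0 μ) (ext0 α) (ext0_antitone hμ)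
    (fun i hi => by simp [ext0, not_lt.2 hi])
    (by
      intro S hS
      have hS' : ∀ x ∈ S, x < n := fun x hx => by simpa using hS hx
      have := h.1 (S.attachFin hS')
      rw [npsum_ext0, card_attachFin] at this
      refine le_trans (le_of_eq ?_) this
      symm
      refine sum_bij (fun i _ => (i : ℕ)) ?_ ?_ ?_ ?_
      · intro i hi; simpa using hi
      · intro i _ j _ hij; exact Fin.ext hij
      · intro b hb; exact ⟨⟨b, hS' b hb⟩, by simpa using hb, rfl⟩
      · intro i _; exact (ext0_fin _ i).symm)
    (by rw [sum_ext0, sum_ext0]; exact h.2)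
  unfold kostka
  refine Set.ncard_ne_zero_of_mem (a := fun r c => if c < μ r then T r c else 0)
    ⟨⟨?_, ?_, ?_⟩, ?_, ?_⟩ (kostka_set_finite μ α)
  · intro r c hc
    dsimp only
    rw [if_pos hc]
    exact h1 r c (by rwa [ext0_fin])
  · intro r c c' hcc hc
    dsimp only
    rw [if_pos hc, if_pos (by omega)]
    exact h2 r c c' hcc (by rwa [ext0_fin])
  · intro r r' hr c hc hc'
    dsimp only
    rw [if_pos hc, if_pos hc']
    exact h3 r r' hr c (by rwa [ext0_fin])
  · intro r c hc
    dsimp only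
    rw [if_neg (by omega)]
  · intro i
    rw [ncard_cells μ (fun r c => if c < μ r then T r c else 0), ← ext0_fin α i, ← h4 i i.2, ← Fin.sum_univ_eq_sum_range
      (fun r => #{c ∈ range (ext0 μ r) | T r c = i + 1})]
    apply sum_congr rfl
    intro r _
    rw [ext0_fin]
    congr 1
    apply filter_congr
    intro c hc
    rw [if_pos (by simpa using hc)]

theorem dom_of_kostka_ne_zero {n : ℕ} {μ : Fin n → ℕ} (hμ : Antitone μ) {α : Fin n →₀ ℕ}
    (h : kostka μ α ≠ 0) : Dom μ α := by
  unfold kostka at h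
  obtain ⟨T, ⟨h1, h2, h3⟩, _, h5⟩ := Set.nonempty_of_ncard_ne_zero h
  obtain ⟨B, hB⟩ : ∃ B, B = ∑ i, μ i := ⟨_, rfl⟩
  have hμB : ∀ r, μ r ≤ B := fun r => hB ▸ single_le_sum (fun i _ => Nat.zero_le _) (mem_univ r)
  have key : ∀ S : Finset (Fin n), ∑ i ∈ S, α i
      = ∑ r : Fin n, #{c ∈ range (μ r) | ∃ i ∈ S, T r c = (i : ℕ) + 1} := by
    intro S
    simp only [h5, ncard_cells]
    rw [sum_comm]
    apply sum_congr rfl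
    intro r _
    rw [← card_biUnion]
    · congr 1
      ext c
      simp only [mem_biUnion, mem_filter, mem_range]
      constructor
      · rintro ⟨i, hi, hc, ht⟩; exact ⟨hc, i, hi, ht⟩
      · rintro ⟨hc, i, hi, ht⟩; exact ⟨i, hi, hc, ht⟩
    · intro i _ j _ hij
      rw [Function.onFun, disjoint_left]
      intro c hc hc'
      simp only [mem_filter] at hc hc'
      apply hij
      apply Fin.ext
      omega
  constructor
  · intro S
    rw [key]
    have swap : ∀ P : Fin n → ℕ → Prop, [∀ r c, Decidable (P r c)] →
        ∑ r : Fin n, #{c ∈ range (μ r) | P r c} =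
        ∑ c ∈ range B, #{r : Fin n | c < μ r ∧ P r c} := by
      intro P _
      have : ∀ r : Fin n, #{c ∈ range (μ r) | P r c}
          = ∑ c ∈ range B, if c < μ r ∧ P r c then 1 else 0 := by
        intro r
        rw [← card_filter]
        congr 1
        ext c
        have := hμB r
        simp only [mem_filter, mem_range]
        constructor
        · rintro ⟨h, h'⟩; exact ⟨by omega, h, h'⟩
        · rintro ⟨_, h, h'⟩; exact ⟨h, h'⟩
      simp only [this, card_filter]
      rw [sum_comm]
    have e2 : npsum μ (#S) = ∑ r : Fin n, #{c ∈ range (μ r) | (r : ℕ) < #S} := by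
      unfold npsum
      apply sum_congr rfl
      intro r _
      split_ifs with h <;> simp [h]
    rw [e2, swap, swap]
    apply sum_le_sum
    intro c _
    by_cases hex : ∃ r : Fin n, c < μ r ∧ #S ≤ (r : ℕ)
    · obtain ⟨r, hr, hSr⟩ := hex
      have e3 : #{r : Fin n | c < μ r ∧ ∃ i ∈ S, T r c = (i : ℕ) + 1} ≤ #S := by
        rw [← card_map (s := S) (Fin.valEmbedding.trans (addRightEmbedding 1))]
        apply card_le_card_of_injOn (fun r => T r c)
        · intro r hr
          simp at hr ⊢
          obtain ⟨_, i, hi, ht⟩ := hr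
          exact ⟨i, hi, ht.symm⟩
        · intro r hr r' hr' hT
          simp at hr hr' hT
          rcases lt_trichotomy r r' with hlt | he | hlt
          · have := h3 r r' hlt c hr'.1 hr.1; omega
          · exact he
          · have := h3 r' r hlt c hr.1 hr'.1; omega
      refine e3.trans ?_
      have hSn : #S ≤ n := by omega
      calc #S = #((univ : Finset (Fin (#S))).map (Fin.castLEEmb hSn)) := by simp
        _ ≤ _ := by
          apply card_le_card
          intro x hx
          simp at hx ⊢
          obtain ⟨y, rfl⟩ := hx
          refine ⟨lt_of_lt_of_le hr (hμ ?_), by simp⟩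
          rw [Fin.le_def]; simp; omega
    · push Not at hex
      apply card_le_card
      intro r hr
      simp only [mem_filter, mem_univ, true_and] at hr ⊢
      exact ⟨hr.1, hex r hr.1⟩
  · rw [key]
    apply sum_congr rfl
    intro r _
    rw [filter_true_of_mem, card_range]
    intro c hc
    have := h1 r c (by simpa using hc)
    exact ⟨⟨T r c - 1, by omega⟩, mem_univ _, by simp; omega⟩

/-! ### Rado's theorem -/

theorem abel_aux (d e : ℕ → ℝ) (t : ℕ) (hd : ∀ i, i < t → d (i + 1) ≤ d i)
    (he : ∀ s, s ≤ t → 0 ≤ ∑ i ∈ range s, e i) :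
    d t * ∑ i ∈ range (t + 1), e i ≤ ∑ i ∈ range (t + 1), d i * e i := by
  induction t with
  | zero => simp
  | succ t ih =>
    have h1 := ih (fun i hi => hd i (by omega)) (fun s hs => he s (by omega))
    rw [sum_range_succ e (t + 1), sum_range_succ (fun i => d i * e i) (t + 1)]
    have h2 := mul_le_mul_of_nonneg_right (hd t (by omega)) (he (t + 1) le_rfl)
    rw [mul_add]
    linarith

theorem abel_fin {n : ℕ} (d e : Fin n → ℝ) (hd : Antitone d)
    (he : ∀ t, t ≤ n → 0 ≤ psum e t) (hs : ∑ i, e i = 0) : 0 ≤ ∑ i, d i * e i := by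
  cases n with
  | zero => simp
  | succ m =>
    let d' : ℕ → ℝ := fun i => if h : i < m + 1 then d ⟨i, h⟩ else 0
    let e' : ℕ → ℝ := fun i => if h : i < m + 1 then e ⟨i, h⟩ else 0
    have hd' : ∀ i : Fin (m + 1), d' i = d i := fun i => dif_pos i.2
    have he' : ∀ i : Fin (m + 1), e' i = e i := fun i => dif_pos i.2
    have hE : ∀ t, t ≤ m + 1 → ∑ i ∈ range t, e' i = psum e t := by
      intro t ht
      have : psum e t = ∑ i ∈ range (m + 1), if i < t then e' i else 0 := by
        rw [← Fin.sum_univ_eq_sum_range (fun i => if i < t then e' i else 0)]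
        simp [he', psum]
      rw [this, ← sum_filter]
      congr 1
      ext i
      simp only [mem_range, mem_filter]
      omega
    have := abel_aux d' e' m (by
      intro i hi
      simp only [d']
      rw [dif_pos (by omega), dif_pos (by omega)]
      apply hd
      simp) (by
      intro s hs
      rw [hE s (by omega)]
      exact he s (by omega))
    rw [← Fin.sum_univ_eq_sum_range, ← Fin.sum_univ_eq_sum_range (fun i => d' i * e' i)] at this
    simpa [hd', he', hs] using this

theorem rado {n : ℕ} (μ α : Fin n → ℕ) (h : Dom μ α) :
    (fun i => (α i : ℝ)) ∈ permutahedron (fun i => (μ i : ℝ)) := by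
  by_contra hx
  have hfin : {w : Fin n → ℝ | ∃ σ : Equiv.Perm (Fin n), w = (fun i => (μ i : ℝ)) ∘ σ}.Finite := by
    have : {w : Fin n → ℝ | ∃ σ : Equiv.Perm (Fin n), w = (fun i => (μ i : ℝ)) ∘ σ}
        = Set.range (fun σ : Equiv.Perm (Fin n) => (fun i => (μ i : ℝ)) ∘ σ) := by
      ext w
      constructor
      · rintro ⟨σ, rfl⟩; exact ⟨σ, rfl⟩
      · rintro ⟨σ, rfl⟩; exact ⟨σ, rfl⟩
    rw [this]
    exact Set.finite_range _
  obtain ⟨f, u, hf1, hf2⟩ := geometric_hahn_banach_closed_point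
    (convex_convexHull ℝ _) (hfin.isClosed_convexHull ℝ) hx
  let c : Fin n → ℝ := fun i => f (Pi.single i 1)
  have hfc : ∀ y : Fin n → ℝ, f y = ∑ i, c i * y i := by
    intro y
    have hy : y = ∑ i, y i • (Pi.single i (1 : ℝ) : Fin n → ℝ) := pi_eq_sum_univ' y |>.trans (by
      apply sum_congr rfl
      intro i _
      congr 1)
    conv_lhs => rw [hy]
    rw [map_sum]
    apply sum_congr rfl
    intro i _
    rw [map_smul, smul_eq_mul, mul_comm]
  obtain ⟨τ, hτ⟩ : ∃ τ : Equiv.Perm (Fin n), Antitone (c ∘ τ) := by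
    refine ⟨Tuple.sort (fun i => - c i), ?_⟩
    intro i j hij
    have := Tuple.monotone_sort (fun i => - c i) hij
    simp at this
    exact this
  have h1 := hf1 ((fun i => (μ i : ℝ)) ∘ τ.symm) (subset_convexHull ℝ _ ⟨τ.symm, rfl⟩)
  have h2 := abel_fin (c ∘ τ) (fun i => (μ i : ℝ) - α (τ i)) hτ (by
    intro t ht
    let S : Finset (Fin n) := ({i : Fin n | (i : ℕ) < t} : Finset (Fin n)).map τ.toEmbedding
    have hcard : #S = t := by
      rw [card_map]
      rw [Fin.card_filter_val_lt]
      omega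
    have h3 := h.1 S
    rw [hcard] at h3
    simp only [S, sum_map, Equiv.coe_toEmbedding, npsum] at h3
    rw [← sum_filter] at h3
    unfold psum
    rw [← sum_filter, sum_sub_distrib, sub_nonneg]
    exact_mod_cast h3) (by
    rw [sum_sub_distrib, Equiv.sum_comp τ (fun i => (α i : ℝ)), sub_eq_zero]
    exact_mod_cast h.2.symm)
  rw [hfc] at h1 hf2
  rw [← Equiv.sum_comp τ] at h1 hf2
  simp only [Function.comp, mul_sub, sum_sub_distrib, Equiv.symm_apply_apply] at h1 h2 hf2
  linarith

theorem sum_le_range {f : ℕ → ℕ} (hf : Antitone f) (S : Finset ℕ) :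
    ∑ i ∈ S, f i ≤ ∑ i ∈ range (#S), f i := by
  induction S using Finset.induction_on_max with
  | empty => simp
  | insert a s hs ih =>
    have ha : a ∉ s := fun h => lt_irrefl _ (hs a h)
    rw [sum_insert ha, card_insert_of_notMem ha, sum_range_succ]
    have : #s ≤ a := by
      have : s ⊆ range a := fun x hx => by simpa using hs x hx
      simpa using card_le_card this
    have := hf this
    omega

theorem dom_perm {n : ℕ} {μ : Fin n → ℕ} (hμ : Antitone μ) (σ : Equiv.Perm (Fin n)) :
    Dom μ (μ ∘ σ) := by
  constructor
  · intro S
    rw [npsum_ext0]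
    have := sum_le_range (ext0_antitone hμ) (S.map (σ.toEmbedding.trans Fin.valEmbedding))
    rw [card_map, sum_map] at this
    simpa [ext0_fin] using this
  · exact Equiv.sum_comp σ μ

theorem newton_snp_of_support {n : ℕ} (f : MvPolynomial (Fin n) ℝ) {μ : Fin n → ℕ}
    (hμ : Antitone μ) (hf : ∀ α : Fin n →₀ ℕ, MvPolynomial.coeff α f ≠ 0 ↔ Dom μ α) :
    newton f = permutahedron (fun i => (μ i : ℝ)) ∧ SNP f := by
  constructor
  · apply Set.Subset.antisymm
    · apply convexHull_min _ (convex_convexHull ℝ _)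
      rintro _ ⟨α, hα, rfl⟩
      apply rado
      rw [← hf]
      simpa using hα
    · apply convexHull_mono
      rintro _ ⟨σ, rfl⟩
      refine ⟨Finsupp.equivFunOnFinite.symm (μ ∘ σ), ?_, ?_⟩
      · have := (hf (Finsupp.equivFunOnFinite.symm (μ ∘ σ))).2 (dom_perm hμ σ)
        simpa using this
      · rfl
  · intro α hα
    rw [hf]
    let C : Set (Fin n → ℝ) := {x | (∀ S : Finset (Fin n), ∑ i ∈ S, x i ≤ (npsum μ (#S) : ℝ)) ∧
      ∑ i, x i = ((∑ i, μ i : ℕ) : ℝ)}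
    have hC : Convex ℝ C := by
      intro x hx y hy a b ha hb hab
      constructor
      · intro S
        simp only [Pi.add_apply, Pi.smul_apply, smul_eq_mul, sum_add_distrib, ← mul_sum]
        have h1 := mul_le_mul_of_nonneg_left (hx.1 S) ha
        have h2 := mul_le_mul_of_nonneg_left (hy.1 S) hb
        have h3 : a * (npsum μ (#S) : ℝ) + b * (npsum μ (#S) : ℝ) = npsum μ (#S) := by
          rw [← add_mul, hab, one_mul]
        linarith
      · simp only [Pi.add_apply, Pi.smul_apply, smul_eq_mul, sum_add_distrib, ← mul_sum]
        rw [hx.2, hy.2, ← add_mul, hab, one_mul]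
    have hsub : newton f ⊆ C := by
      apply convexHull_min _ hC
      rintro _ ⟨β, hβ, rfl⟩
      have hd : Dom μ β := by rw [← hf]; simpa using hβ
      constructor
      · intro S
        have := hd.1 S
        dsimp only
        exact_mod_cast this
      · have := hd.2
        dsimp only
        exact_mod_cast this
    have := hsub hα
    constructor
    · intro S
      have h1 := this.1 S
      dsimp only at h1
      exact_mod_cast h1
    · have h1 := this.2
      dsimp only at h1
      exact_mod_cast h1

/-! ### The northmost chain -/

/-- Partitions between `lam` and `lam + (0, 1, 2, …)`. -/
def InL {n : ℕ} (lam m : Fin n → ℕ) : Prop :=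
  Antitone m ∧ (∀ i, lam i ≤ m i) ∧ ∀ i, m i ≤ lam i + (i : ℕ)

/-- Invariant of the northmost chain. -/
def ChainInv {n : ℕ} (lam μ : Fin n → ℕ) : Prop :=
  InL lam μ ∧ ∃ ρ : ℕ, (∀ i : Fin n, (i : ℕ) < ρ → ∀ m, InL lam m → m i ≤ μ i) ∧
    ∀ i : Fin n, ρ < (i : ℕ) → μ i = lam i

theorem antitone_update {n : ℕ} {μ : Fin n → ℕ} (hμ : Antitone μ) (i : Fin n)
    (h : ∀ j : Fin n, (j : ℕ) + 1 = i → μ i < μ j) :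
    Antitone (Function.update μ i (μ i + 1)) := by
  intro a b hab
  by_cases hb : b = i
  · subst hb
    by_cases ha : a = b
    · subst ha; exact le_rfl
    · rw [Function.update_self, Function.update_of_ne ha]
      have hlt : a < b := lt_of_le_of_ne hab ha
      rw [Fin.lt_def] at hlt
      have hb1 := b.2
      have h1 := h ⟨(b : ℕ) - 1, by omega⟩ (by simp; omega)
      have h2 : μ ⟨(b : ℕ) - 1, by omega⟩ ≤ μ a := hμ (by rw [Fin.le_def]; simp; omega)
      omega
  · rw [Function.update_of_ne hb]
    by_cases ha : a = i
    · subst ha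
      rw [Function.update_self]
      have := hμ hab
      omega
    · rw [Function.update_of_ne ha]
      exact hμ hab

theorem chainInv_step {n : ℕ} {lam μ μ' : Fin n → ℕ} (h : ChainInv lam μ)
    (hs : NorthStep lam μ μ') : ChainInv lam μ' ∧ ∑ i, μ' i = ∑ i, μ i + 1 := by
  obtain ⟨⟨hanti, hle, hub⟩, ρ, hρ1, hρ2⟩ := h
  obtain ⟨r, ⟨hr1, hr2⟩, hr3, rfl⟩ := hs
  have hge : ∀ i, μ i ≤ Function.update μ r (μ r + 1) i := by
    intro i
    by_cases hi : i = r
    · subst hi; simp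
    · simp [Function.update_of_ne hi]
  have hL : InL lam (Function.update μ r (μ r + 1)) := by
    refine ⟨hr2, fun i => (hle i).trans (hge i), ?_⟩
    intro i
    by_cases hi : i = r
    · subst hi; simp; omega
    · rw [Function.update_of_ne hi]; exact hub i
  refine ⟨⟨hL, (r : ℕ), ?_, ?_⟩, ?_⟩
  · have : ∀ k : ℕ, ∀ i : Fin n, (i : ℕ) = k → (i : ℕ) < r → ∀ m, InL lam m → m i ≤ μ i := by
      intro k
      induction k with
      | zero =>
        intro i hi _ m hm
        have := hm.2.2 i
        have := hle i
        omega
      | succ k ih =>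
        intro i hi hir m hm
        by_contra hcon
        push Not at hcon
        apply hr3 i hir
        have h1 := hm.2.2 i
        refine ⟨by omega, antitone_update hanti i ?_⟩
        intro j hj
        have h2 := ih j (by omega) (by omega) m hm
        have h3 : m i ≤ m j := hm.1 (by rw [Fin.le_def]; omega)
        omega
    intro i hi m hm
    exact (this i i rfl hi m hm).trans (hge i)
  · intro i hi
    have hρr : ρ ≤ (r : ℕ) := by
      by_contra hcon
      have := hρ1 r (by omega) _ hL
      simp at this
    rw [Function.update_of_ne (by rintro rfl; omega)]
    exact hρ2 i (by omega)
  · rw [sum_update_of_mem (mem_univ r), sum_eq_add_sum_sdiff_singleton_of_mem (mem_univ r) μ]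
    omega

theorem chainInv_dom {n : ℕ} {lam μ m : Fin n → ℕ} (h : ChainInv lam μ) (hm : InL lam m)
    (hsum : ∑ i, m i = ∑ i, μ i) (t : ℕ) : npsum m t ≤ npsum μ t := by
  obtain ⟨-, ρ, hρ1, hρ2⟩ := h
  unfold npsum
  by_cases ht : t ≤ ρ
  · apply sum_le_sum
    intro i _
    split_ifs with hi
    · exact hρ1 i (by omega) m hm
    · exact le_rfl
  · have hsplit : ∀ v : Fin n → ℕ, ∑ i, v i
        = (∑ i : Fin n, if (i : ℕ) < t then v i else 0) + ∑ i : Fin n, if (i : ℕ) < t then 0 else v i := by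
      intro v
      rw [← sum_add_distrib]
      apply sum_congr rfl
      intro i _
      split_ifs <;> simp
    have h1 : (∑ i : Fin n, if (i : ℕ) < t then 0 else μ i)
        ≤ ∑ i : Fin n, if (i : ℕ) < t then 0 else m i := by
      apply sum_le_sum
      intro i _
      split_ifs with hi
      · exact le_rfl
      · rw [hρ2 i (by omega)]; exact hm.2.1 i
    rw [hsplit m, hsplit μ] at hsum
    omega

/-! ### Nonvanishing of the Schur coefficients -/

theorem flaggedCount_ne_zero {n : ℕ} {lam m : Fin n → ℕ} (hm : InL lam m) :
    flaggedCount lam m ≠ 0 := by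
  obtain ⟨hanti, hle, hub⟩ := hm
  have hfin : {T : Fin n → ℕ → ℕ | IsFlaggedTableau lam m T ∧
      ∀ (r : Fin n) (c : ℕ), (c < lam r ∨ m r ≤ c) → T r c = 0}.Finite := by
    apply finite_tab (∑ i, m i) n
    · rintro T ⟨_, h⟩ r c hc
      exact h r c (Or.inr ((single_le_sum (fun i _ => Nat.zero_le _) (mem_univ r)).trans hc))
    · rintro T ⟨h1, h2⟩ r c
      by_cases hc : c < lam r ∨ m r ≤ c
      · rw [h2 r c hc]; omega
      · have := (h1.2.1 r c (by omega) (by omega)).2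
        omega
  let g : Fin n → ℕ := fun r => (Iic r).inf' ⟨r, by simp⟩ (fun r' => (r' : ℕ) + lam r')
  have hg1 : ∀ r r', r' ≤ r → g r ≤ (r' : ℕ) + lam r' := by
    intro r r' h
    exact inf'_le (fun r' : Fin n => (r' : ℕ) + lam r') (by simpa using h)
  have hg2 : ∀ r r', r' ≤ r → g r ≤ g r' := by
    intro r r' h
    apply le_inf'
    intro b hb
    exact hg1 r b ((by simpa using hb : b ≤ r').trans h)
  have hg3 : ∀ r c, c < m r → c + 1 ≤ g r := by
    intro r c hc
    apply le_inf'
    intro b hb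
    have h1 : m r ≤ m b := hanti (by simpa using hb)
    have := hub b
    omega
  refine Set.ncard_ne_zero_of_mem
    (a := fun r c => if lam r ≤ c ∧ c < m r then (r : ℕ) + c + 1 - g r else 0)
    ⟨⟨hle, ?_, ?_, ?_⟩, ?_⟩ hfin
  · intro r c h1 h2
    dsimp only
    rw [if_pos ⟨h1, h2⟩]
    have := hg1 r r le_rfl
    have := hg3 r c h2
    omega
  · intro r c c' h1 h2 h3
    dsimp only
    rw [if_pos ⟨h1, by omega⟩, if_pos ⟨by omega, h3⟩]
    have := hg1 r r le_rfl
    omega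
  · intro r r' hr c h1 h2 h3 h4
    dsimp only
    rw [if_pos ⟨h1, h2⟩, if_pos ⟨h3, h4⟩]
    have := hg1 r r le_rfl
    have := hg2 r' r hr.le
    rw [Fin.lt_def] at hr
    omega
  · intro r c h
    dsimp only
    rw [if_neg (by omega)]

theorem coeff_schur {n : ℕ} {m : Fin n → ℕ} (hm : Antitone m) (α : Fin n →₀ ℕ) :
    MvPolynomial.coeff α (schur m) = kostka m α := by
  unfold schur
  rw [MvPolynomial.coeff_sum]
  simp only [MvPolynomial.coeff_smul, MvPolynomial.coeff_monomial, smul_eq_mul, mul_ite, mul_one,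
    mul_zero]
  rw [sum_ite_eq']
  split_ifs with h
  · rfl
  · symm
    rw [Nat.cast_eq_zero]
    by_contra hk
    apply h
    have hd := dom_of_kostka_ne_zero hm hk
    rw [mem_Iic]
    intro i
    change α i ≤ ∑ i, m i
    rw [← hd.2]
    exact single_le_sum (fun i _ => Nat.zero_le _) (mem_univ i)

theorem coeff_component {n : ℕ} {lam μ : Fin n → ℕ} (k : ℕ) (h : ChainInv lam μ)
    (hk : ∑ i, μ i = ∑ i, lam i + k) (α : Fin n →₀ ℕ) :
    MvPolynomial.coeff α (MvPolynomial.homogeneousComponent (∑ i, lam i + k) (grothendieck lam)) ≠ 0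
      ↔ Dom μ α := by
  classical
  rw [MvPolynomial.coeff_homogeneousComponent]
  have hdeg : α.degree = ∑ i, α i := Finsupp.degree_eq_sum α
  rw [hdeg]
  by_cases hα : ∑ i, α i = ∑ i, lam i + k
  swap
  · rw [if_neg hα]
    simp only [ne_eq, not_true_eq_false, false_iff]
    intro hd
    exact hα (hd.2.trans hk)
  rw [if_pos hα]
  have hco : MvPolynomial.coeff α (grothendieck lam) = (-1 : ℝ) ^ k *
      ∑ m ∈ Finset.Iic (Finsupp.equivFunOnFinite.symm (fun i : Fin n => lam i + (i : ℕ))),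
        if Antitone (fun i => m i) ∧ ∀ i, lam i ≤ m i then
          ((flaggedCount lam (fun i => m i) * kostka (fun i => m i) α : ℕ) : ℝ) else 0 := by
    unfold grothendieck
    rw [MvPolynomial.coeff_sum, mul_sum]
    apply sum_congr rfl
    intro m _
    rw [MvPolynomial.coeff_smul, smul_eq_mul]
    unfold grothCoeff
    split_ifs with hm
    · rw [coeff_schur hm.1]
      by_cases hK : kostka (fun i => m i) α = 0
      · simp [hK]
      · have hd := dom_of_kostka_ne_zero hm.1 hK
        have : ∑ i, m i - ∑ i, lam i = k := by
          have := hd.2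
          dsimp only at this
          omega
        rw [this]
        push_cast
        ring
    · simp
  rw [hco, mul_ne_zero_iff]
  have hpow : (-1 : ℝ) ^ k ≠ 0 := pow_ne_zero _ (by norm_num)
  simp only [hpow, ne_eq, not_false_eq_true, true_and]
  rw [sum_eq_zero_iff_of_nonneg (by
    intro m _
    split_ifs
    · exact Nat.cast_nonneg _
    · exact le_rfl)]
  push Not
  constructor
  · rintro ⟨m, hm, hne⟩
    rw [mem_Iic] at hm
    split_ifs at hne with hc
    · have hne' : kostka (fun i => m i) α ≠ 0 := by
        intro h0
        rw [h0] at hne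
        simp at hne
      have hd := dom_of_kostka_ne_zero hc.1 hne'
      have hs : ∑ i, m i = ∑ i, μ i := by rw [← hd.2, hα, hk]
      refine ⟨fun S => (hd.1 S).trans (chainInv_dom h ⟨hc.1, hc.2, fun i => hm i⟩ hs _), ?_⟩
      rw [hα, hk]
    · exact absurd rfl hne
  · intro hd
    refine ⟨Finsupp.equivFunOnFinite.symm μ, ?_, ?_⟩
    · rw [mem_Iic]
      intro i
      exact h.1.2.2 i
    · rw [if_pos ⟨h.1.1, h.1.2.1⟩]
      rw [Nat.cast_ne_zero]
      exact mul_ne_zero (flaggedCount_ne_zero h.1) (kostka_ne_zero_of_dom h.1.1 hd)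

/-- For each `k`, the degree-`(|λ|+k)` homogeneous component of `G_λ` has Newton polytope
equal to the permutahedron `P_{μ^(k)}`, and this component has SNP. -/
theorem component_newton_eq_permutahedron {n N : ℕ} (lam : Fin n → ℕ) (hlam : Antitone lam)
    (μ : Fin (N + 1) → Fin n → ℕ) (h0 : μ 0 = lam)
    (hchain : ∀ k : Fin N, NorthStep lam (μ k.castSucc) (μ k.succ)) :
    ∀ k : Fin (N + 1),
      newton (MvPolynomial.homogeneousComponent (∑ i, lam i + (k : ℕ)) (grothendieck lam))
          = permutahedron (fun i => (μ k i : ℝ)) ∧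
        SNP (MvPolynomial.homogeneousComponent (∑ i, lam i + (k : ℕ)) (grothendieck lam)) := by
  have key : ∀ k : Fin (N + 1), ChainInv lam (μ k) ∧ ∑ i, μ k i = ∑ i, lam i + (k : ℕ) := by
    intro k
    induction k using Fin.induction with
    | zero =>
      rw [h0]
      refine ⟨⟨⟨hlam, fun i => le_rfl, fun i => by omega⟩, 0, ?_, ?_⟩, by simp⟩
      · intro i hi; omega
      · intro i _; rfl
    | succ k ih =>
      obtain ⟨h1, h2⟩ := chainInv_step ih.1 (hchain k)
      refine ⟨h1, ?_⟩
      rw [h2, ih.2]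
      simp
      omega
  intro k
  obtain ⟨h1, h2⟩ := key k
  exact newton_snp_of_support _ h1.1.1 (fun α => coeff_component (k : ℕ) h1 h2 α)
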